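/- arXiv:2308.14095 — 2 statements merged into one kernel-verified Lean document; each statement's English description precedes it below -/
import Mathlib

section
/- For all distinct indices i, j ∈ {1, …, n} and every integer k, the commutator of elementary transformations satisfies T_{i,−j}(ζ^k) ∘ T_{i,j}(1) ∘ T_{i,−j}(ζ^k)⁻¹ ∘ T_{i,j}(1)⁻¹ = T_i(ζ^k + ζ^{−k}) as automorphisms of R^{2n}. -/
open Matrix

/-- The standard basis vector e_p of R^{2n}: for p = Sum.inl i it is e_i
(i ∈ {1, …, n}), and for p = Sum.inr i it is e_{−i}. -/
noncomputable def ee (n : ℕ) (p : Fin n ⊕ Fin n) : Fin n ⊕ Fin n → ℂ :=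
  Pi.single p 1

/-- The sesquilinear intersection form on R^{2n} (linear in the first variable,
conjugate-linear in the second, with ⟨e_i, e_{−i}⟩ = 1 and all other pairs of
basis vectors pairing to 0). -/
noncomputable def PrymForm (n : ℕ) (x y : Fin n ⊕ Fin n → ℂ) : ℂ :=
  ∑ i : Fin n,
    (x (Sum.inl i) * starRingEnd ℂ (y (Sum.inr i))
      - x (Sum.inr i) * starRingEnd ℂ (y (Sum.inl i)))

/-- The elementary transformation T_p(r') : x ↦ x + r'⟨x, e_p⟩e_p. -/
noncomputable def Tsingle (n : ℕ) (p : Fin n ⊕ Fin n) (r : ℂ)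
    (x : Fin n ⊕ Fin n → ℂ) : Fin n ⊕ Fin n → ℂ :=
  x + (r * PrymForm n x (ee n p)) • ee n p

/-- The elementary transformation
T_{p,q}(r) : x ↦ x + r⟨x, e_p⟩e_q + conj(r)⟨x, e_q⟩e_p. -/
noncomputable def Tdouble (n : ℕ) (p q : Fin n ⊕ Fin n) (r : ℂ)
    (x : Fin n ⊕ Fin n → ℂ) : Fin n ⊕ Fin n → ℂ :=
  x + (r * PrymForm n x (ee n p)) • ee n q
    + (starRingEnd ℂ r * PrymForm n x (ee n q)) • ee n p

lemma form_inl (n : ℕ) (x : Fin n ⊕ Fin n → ℂ) (i : Fin n) :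
    PrymForm n x (ee n (Sum.inl i)) = - x (Sum.inr i) := by
  simp [PrymForm, ee, Pi.single_apply, apply_ite]

lemma form_inr (n : ℕ) (x : Fin n ⊕ Fin n → ℂ) (i : Fin n) :
    PrymForm n x (ee n (Sum.inr i)) = x (Sum.inl i) := by
  simp [PrymForm, ee, Pi.single_apply, apply_ite]

/-- For distinct i, j ∈ {1, …, n} and k ∈ ℤ, the commutator identity
T_{i,−j}(ζ^k) ∘ T_{i,j}(1) ∘ T_{i,−j}(ζ^k)⁻¹ ∘ T_{i,j}(1)⁻¹ = T_i(ζ^k + ζ^{−k})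
holds as automorphisms of R^{2n} (here S₁, S₂ are the inverse maps of
T_{i,−j}(ζ^k) and T_{i,j}(1) respectively). -/
theorem stmt_5 (d n : ℕ) (hd : 1 ≤ d) (hn : 2 ≤ n) (ζ : ℂ)
    (hζ : IsPrimitiveRoot ζ d)
    (R : Subring ℂ) (hR : R = Subring.closure {ζ})
    (i j : Fin n) (hij : i ≠ j) (k : ℤ)
    (S₁ S₂ : (Fin n ⊕ Fin n → ℂ) → (Fin n ⊕ Fin n → ℂ))
    (hS₁ : Tdouble n (Sum.inl i) (Sum.inr j) (ζ ^ k) ∘ S₁ = id ∧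
      S₁ ∘ Tdouble n (Sum.inl i) (Sum.inr j) (ζ ^ k) = id)
    (hS₂ : Tdouble n (Sum.inl i) (Sum.inl j) 1 ∘ S₂ = id ∧
      S₂ ∘ Tdouble n (Sum.inl i) (Sum.inl j) 1 = id) :
    ∀ x : Fin n ⊕ Fin n → ℂ, (∀ q, x q ∈ R) →
      Tdouble n (Sum.inl i) (Sum.inr j) (ζ ^ k)
          (Tdouble n (Sum.inl i) (Sum.inl j) 1 (S₁ (S₂ x)))
        = Tsingle n (Sum.inl i) (ζ ^ k + ζ ^ (-k)) x := by
  intro x _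
  have hx : Tdouble n (Sum.inl i) (Sum.inl j) 1
      (Tdouble n (Sum.inl i) (Sum.inr j) (ζ ^ k) (S₁ (S₂ x))) = x := by
    have h1 := congrFun hS₁.1 (S₂ x)
    have h2 := congrFun hS₂.1 x
    simp only [Function.comp_apply, id] at h1 h2
    rw [h1, h2]
  have hnorm : ‖ζ‖ = 1 := hζ.norm'_eq_one (by omega)
  have hc : starRingEnd ℂ (ζ ^ k) = ζ ^ (-k) := by
    rw [_root_.zpow_neg, Complex.inv_eq_conj]
    rw [norm_zpow, hnorm, _root_.one_zpow]
  generalize S₁ (S₂ x) = y at hx ⊢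
  rw [← hx]
  simp only [Tdouble, Tsingle, form_inl, form_inr, hc, map_one]
  generalize ζ ^ k = z
  generalize ζ ^ (-k) = w
  have hji : j ≠ i := hij.symm
  funext q
  simp [ee, Pi.single_apply, hij, hji]
  split_ifs <;> ring
end

section
/- If M ∈ GL_{2n}(R) is block upper triangular (with n×n blocks) and satisfies M*ΩM = Ω, then det M is a root of unity in R; more precisely det M = ±ζ^k for some integer k. In particular, for any unit u of R, the element u · conj(u)⁻¹ is a root of unity of the form ±ζ^k. -/
open Matrix

lemma conj_aux (d : ℕ) (hd : 1 ≤ d) (ζ : ℂ) (hζ : IsPrimitiveRoot ζ d)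
    (K : IntermediateField ℚ ℂ) (hK : ζ ∈ K) (x : ℂ) (hx : x ∈ Subring.closure {ζ}) :
    ∃ a b : K, (a : ℂ) = x ∧ (b : ℂ) = starRingEnd ℂ x ∧ IsIntegral ℤ a ∧ IsIntegral ℤ b ∧
      ∀ φ : K →+* ℂ, φ b = starRingEnd ℂ (φ a) := by
  induction hx using Subring.closure_induction with
  | mem x hx =>
    rw [Set.mem_singleton_iff] at hx
    subst hx
    have h0 : x ^ d = 1 := hζ.pow_eq_one
    have key : ∀ z : ℂ, z ^ d = 1 → z⁻¹ = starRingEnd ℂ z := fun z hz =>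
      Complex.inv_eq_conj (Complex.norm_eq_one_of_pow_eq_one hz (by omega))
    have ha : (⟨x, hK⟩ : K) ^ d = 1 := Subtype.ext (by simpa using h0)
    refine ⟨⟨x, hK⟩, (⟨x, hK⟩ : K)⁻¹, rfl, ?_, ?_, ?_, ?_⟩
    · simpa using key x h0
    · exact IsIntegral.of_pow (n := d) (by omega) (by rw [ha]; exact isIntegral_one)
    · exact IsIntegral.of_pow (n := d) (by omega) (by rw [inv_pow, ha, inv_one]; exact isIntegral_one)
    · intro φ
      rw [map_inv₀]
      exact key _ (by rw [← map_pow, ha, map_one])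
  | zero => exact ⟨0, 0, by simp, by simp, isIntegral_zero, isIntegral_zero, by simp⟩
  | one => exact ⟨1, 1, by simp, by simp, isIntegral_one, isIntegral_one, by simp⟩
  | add x y _ _ h1 h2 =>
    obtain ⟨a, b, ha, hb, hia, hib, h⟩ := h1
    obtain ⟨a', b', ha', hb', hia', hib', h'⟩ := h2
    exact ⟨a + a', b + b', by simp [ha, ha'], by simp [hb, hb'], hia.add hia', hib.add hib',
      fun φ => by simp [h, h']⟩
  | neg x _ h1 =>
    obtain ⟨a, b, ha, hb, hia, hib, h⟩ := h1
    exact ⟨-a, -b, by simp [ha], by simp [hb], hia.neg, hib.neg, fun φ => by simp [h]⟩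
  | mul x y _ _ h1 h2 =>
    obtain ⟨a, b, ha, hb, hia, hib, h⟩ := h1
    obtain ⟨a', b', ha', hb', hia', hib', h'⟩ := h2
    exact ⟨a * a', b * b', by simp [ha, ha'], by simp [hb, hb'], hia.mul hia', hib.mul hib',
      fun φ => by simp [h, h']⟩

lemma root_aux (d : ℕ) [NeZero d] {K : Type*} [Field K] [NumberField K]
    [IsCyclotomicExtension {d} ℚ K] (ζ x : K) (hζ : IsPrimitiveRoot ζ d) (hx : IsOfFinOrder x) :
    ∃ r : ℕ, x = ζ ^ r ∨ x = -ζ ^ r := by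
  rcases Nat.even_or_odd d with he | ho
  · have hl0 : 0 < orderOf x := hx.orderOf_pos
    have hxl := IsPrimitiveRoot.orderOf x
    have hd0 := NeZero.pos d
    have h1 := hxl.dvd_of_isCyclotomicExtension d hl0.ne'
    have h2 := IsPrimitiveRoot.lcm_totient_le_finrank hxl hζ
      (Polynomial.cyclotomic.irreducible_rat <| Nat.lcm_pos hl0 hd0)
    rw [IsCyclotomicExtension.finrank K (Polynomial.cyclotomic.irreducible_rat hd0)] at h2
    have h3 : Nat.lcm (orderOf x) d ∣ 2 * d := Nat.lcm_dvd h1 (Dvd.intro_left _ rfl)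
    obtain ⟨r, hr⟩ := Nat.dvd_lcm_right (orderOf x) d
    have h4 : r ∣ 2 := by
      rw [hr, mul_comm] at h3
      exact Nat.dvd_of_mul_dvd_mul_right hd0 h3
    have hd : orderOf x ∣ d := by
      rcases (Nat.dvd_prime Nat.prime_two).1 h4 with h | h
      · rw [h, mul_one] at hr
        rw [← hr]; exact Nat.dvd_lcm_left _ _
      · exfalso
        rw [hr, h, mul_comm, Nat.totient_mul_of_prime_of_dvd Nat.prime_two he.two_dvd] at h2
        have := Nat.totient_pos.2 hd0
        omega
    obtain ⟨s, -, hs⟩ := hζ.eq_pow_of_pow_eq_one (orderOf_dvd_iff_pow_eq_one.1 hd)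
    exact ⟨s, Or.inl hs.symm⟩
  · obtain ⟨r, -, h⟩ := hζ.exists_pow_or_neg_mul_pow_of_isOfFinOrder ho hx
    exact ⟨r, h⟩

lemma unit_aux (d : ℕ) (hd : 1 ≤ d) (ζ : ℂ) (hζ : IsPrimitiveRoot ζ d)
    (u w : ℂ) (hu : u ∈ Subring.closure {ζ}) (hw : w ∈ Subring.closure {ζ}) (huw : u * w = 1) :
    ∃ k : ℤ, u * (starRingEnd ℂ u)⁻¹ = ζ ^ k ∨ u * (starRingEnd ℂ u)⁻¹ = -ζ ^ k := by
  haveI : NeZero d := ⟨by omega⟩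
  let K := IntermediateField.adjoin ℚ {ζ}
  have hint : IsIntegral ℚ ζ := (hζ.isIntegral (by omega)).tower_top
  have hK : ζ ∈ K := IntermediateField.mem_adjoin_simple_self ℚ ζ
  haveI hcyc : IsCyclotomicExtension {d} ℚ K := by
    change IsCyclotomicExtension {d} ℚ (IntermediateField.adjoin ℚ {ζ}).toSubalgebra
    rw [IntermediateField.adjoin_simple_toSubalgebra_of_isAlgebraic hint.isAlgebraic]
    exact hζ.adjoin_isCyclotomicExtension ℚ
  haveI : NumberField K := IsCyclotomicExtension.numberField {d} ℚ K
  obtain ⟨a, b, ha, hb, hia, hib, h⟩ := conj_aux d hd ζ hζ K hK u hu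
  obtain ⟨a', b', ha', hb', hia', hib', h'⟩ := conj_aux d hd ζ hζ K hK w hw
  have haa : a * a' = 1 := Subtype.ext (by simp [ha, ha', huw])
  obtain ⟨m, hm, hx⟩ := NumberField.Embeddings.pow_eq_one_of_norm_eq_one K ℂ
    (x := a * b') (hia.mul hib') (fun φ => by
      rw [map_mul, h', norm_mul, RCLike.norm_conj, ← norm_mul, ← map_mul, haa]; simp)
  have hζ' : IsPrimitiveRoot (⟨ζ, hK⟩ : K) d :=
    IsPrimitiveRoot.of_map_of_injective (f := K.val) hζ K.val.injective
  obtain ⟨r, hr⟩ := root_aux d _ _ hζ' (isOfFinOrder_iff_pow_eq_one.2 ⟨m, hm, hx⟩)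
  have e : u * (starRingEnd ℂ u)⁻¹ = ((a * b' : K) : ℂ) := by
    have : starRingEnd ℂ u * starRingEnd ℂ w = 1 := by rw [← map_mul, huw, map_one]
    rw [inv_eq_of_mul_eq_one_right this]
    simp [ha, hb']
  refine ⟨r, ?_⟩
  rw [e, zpow_natCast]
  rcases hr with hr | hr
  · left; rw [hr]; simp
  · right; rw [hr]; simp

lemma det_mem_aux {m : Type*} [Fintype m] [DecidableEq m] (R : Subring ℂ) (M : Matrix m m ℂ)
    (h : ∀ p q, M p q ∈ R) : M.det ∈ R := by
  rw [Matrix.det_apply]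
  refine R.sum_mem fun σ _ => ?_
  rw [Units.smul_def]
  exact R.zsmul_mem (R.prod_mem fun i _ => h _ _) _

/-- If M ∈ GL_{2n}(R) is block upper triangular and satisfies M*ΩM = Ω, then
det M = ±ζ^k for some integer k (a root of unity in R). In particular, for any
unit u of R, the element u · conj(u)⁻¹ is of the form ±ζ^k. -/
theorem stmt_11 (d n : ℕ) (hd : 1 ≤ d) (hn : 1 ≤ n) (ζ : ℂ)
    (hζ : IsPrimitiveRoot ζ d)
    (R : Subring ℂ) (hR : R = Subring.closure {ζ})
    (Ω : Matrix (Fin n ⊕ Fin n) (Fin n ⊕ Fin n) ℂ)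
    (hΩ : Ω = Matrix.fromBlocks 0 1 (-1) 0) :
    (∀ M : Matrix (Fin n ⊕ Fin n) (Fin n ⊕ Fin n) ℂ,
      (∀ p q, M p q ∈ R) →
      (∃ M' : Matrix (Fin n ⊕ Fin n) (Fin n ⊕ Fin n) ℂ,
        (∀ p q, M' p q ∈ R) ∧ M * M' = 1 ∧ M' * M = 1) →
      (∀ i j : Fin n, M (Sum.inr i) (Sum.inl j) = 0) →
      Mᴴ * Ω * M = Ω →
      ∃ k : ℤ, M.det = ζ ^ k ∨ M.det = -ζ ^ k) ∧
    (∀ u : ℂ, u ∈ R → (∃ w ∈ R, u * w = 1) →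
      ∃ k : ℤ, u * (starRingEnd ℂ u)⁻¹ = ζ ^ k ∨ u * (starRingEnd ℂ u)⁻¹ = -ζ ^ k) := by
  subst hR hΩ
  have hunit : ∀ u : ℂ, u ∈ Subring.closure {ζ} → (∃ w ∈ Subring.closure {ζ}, u * w = 1) →
      ∃ k : ℤ, u * (starRingEnd ℂ u)⁻¹ = ζ ^ k ∨ u * (starRingEnd ℂ u)⁻¹ = -ζ ^ k := by
    rintro u hu ⟨w, hw, huw⟩
    exact unit_aux d hd ζ hζ u w hu hw huw
  refine ⟨?_, hunit⟩
  rintro M hM ⟨M', hM', hMM', -⟩ hM0 hΩ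
  have hblk : M = Matrix.fromBlocks M.toBlocks₁₁ M.toBlocks₁₂ 0 M.toBlocks₂₂ := by
    conv_lhs => rw [← Matrix.fromBlocks_toBlocks M]
    congr 1
    ext i j
    exact hM0 i j
  set A := M.toBlocks₁₁ with hA
  set B := M.toBlocks₁₂
  set D := M.toBlocks₂₂ with hD
  have hdet : M.det = A.det * D.det := by rw [hblk, Matrix.det_fromBlocks_zero₂₁]
  have hAD : Aᴴ * D = 1 := by
    rw [hblk, Matrix.fromBlocks_conjTranspose, Matrix.fromBlocks_multiply,
      Matrix.fromBlocks_multiply] at hΩ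
    have := (Matrix.fromBlocks_inj.1 hΩ).2.1
    simpa using this
  have hAD' : starRingEnd ℂ A.det * D.det = 1 := by
    have := congrArg Matrix.det hAD
    rwa [Matrix.det_mul, Matrix.det_conjTranspose, Matrix.det_one] at this
  have hAm : A.det ∈ Subring.closure {ζ} := det_mem_aux _ _ fun p q => hM _ _
  have hDm : D.det ∈ Subring.closure {ζ} := det_mem_aux _ _ fun p q => hM _ _
  have hM'm : M'.det ∈ Subring.closure {ζ} := det_mem_aux _ _ hM'
  have h1 : M.det * M'.det = 1 := by rw [← Matrix.det_mul, hMM', Matrix.det_one]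
  have := hunit A.det hAm ⟨D.det * M'.det, Subring.mul_mem _ hDm hM'm, by
    rw [← mul_assoc, ← hdet, h1]⟩
  rwa [inv_eq_of_mul_eq_one_right hAD', ← hdet] at this
end
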